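/- arXiv:1811.06350 — 4 statements merged into one kernel-verified Lean document; each statement's English description precedes it below -/
import Mathlib

section
/- Let F be a nonempty closed subset of ℝⁿ and let f : ℝⁿ → ℝⁿ be Lipschitz continuous. Suppose that for every x ∈ F, f(x) belongs to the contingent cone T_F(x). Then F is positively invariant: for every T ≥ 0 and every differentiable curve x : [0,T] → ℝⁿ satisfying x'(t) = f(x(t)) for all t ∈ [0,T] and x(0) ∈ F, one has x(t) ∈ F for all t ∈ [0,T]. (Sufficiency direction of the Nagumo theorem.) -/
open Filter Metric Set Topology

/-- If the real-valued liminf of the quotients `d_F(y + h v) / h` vanishes at `y ∈ F`, these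
quotients are frequently smaller than any positive number as `h → 0⁺`. -/
theorem frequently_infDist_lt_of_liminf_eq_zero {E : Type*} [NormedAddCommGroup E]
    [NormedSpace ℝ E] {F : Set E} {y v : E} (hy : y ∈ F)
    (h : liminf (fun h : ℝ => infDist (y + h • v) F / h) (𝓝[>] 0) = 0) {r : ℝ} (hr : 0 < r) :
    ∃ᶠ h in 𝓝[>] (0 : ℝ), infDist (y + h • v) F < r * h := by
  have hb : IsBoundedUnder (· ≤ ·) (𝓝[>] (0 : ℝ))
      (fun h : ℝ => infDist (y + h • v) F / h) := by
    refine isBoundedUnder_of_eventually_le (a := ‖v‖) ?_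
    filter_upwards [self_mem_nhdsWithin] with h (hh : 0 < h)
    rw [div_le_iff₀ hh]
    refine (infDist_le_dist_of_mem hy).trans ?_
    rw [dist_eq_norm, add_sub_cancel_left, norm_smul, Real.norm_of_nonneg hh.le, mul_comm]
  have hfreq := frequently_lt_of_liminf_lt hb.isCoboundedUnder_ge (h.trans_lt hr)
  refine (hfreq.and_eventually self_mem_nhdsWithin).mono ?_
  rintro s ⟨hs, hs0⟩
  exact (div_lt_iff₀ hs0).1 hs

/-- Along a solution of `ẋ = f(x)`, the distance to `F` has lower right Dini derivative at most
`K` times itself when `f` is `K`-Lipschitz and tangent to `F`. -/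
theorem frequently_slope_infDist_lt {E : Type*} [NormedAddCommGroup E] [NormedSpace ℝ E]
    [ProperSpace E] {F : Set E} (hFne : F.Nonempty) (hFcl : IsClosed F) {f : E → E}
    {K : NNReal} (hf : LipschitzWith K f)
    (htan : ∀ y ∈ F, liminf (fun h : ℝ => infDist (y + h • f y) F / h) (𝓝[>] 0) = 0)
    {x : ℝ → E} {t : ℝ} (hx : HasDerivAt x (f (x t)) t) {r : ℝ}
    (hr : K * infDist (x t) F < r) :
    ∃ᶠ z in 𝓝[>] t, (z - t)⁻¹ * (infDist (x z) F - infDist (x t) F) < r := by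
  obtain ⟨y, hy, hyd⟩ := hFcl.exists_infDist_eq_dist hFne (x t)
  set ε := (r - K * infDist (x t) F) / 2 with hε
  have hε0 : 0 < ε := by linarith
  have ho := ((hasDerivAt_iff_isLittleO_nhds_zero.1 hx).def hε0).filter_mono
    (nhdsWithin_le_nhds (s := Ioi 0))
  have hfreq := (frequently_infDist_lt_of_liminf_eq_zero hy (htan y hy) hε0).and_eventually
    (ho.and self_mem_nhdsWithin)
  have htend : Tendsto (fun h : ℝ => t + h) (𝓝[>] 0) (𝓝[>] t) := by
    refine tendsto_nhdsWithin_iff.2 ⟨?_, ?_⟩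
    · exact ((continuous_const_add t).tendsto' 0 t (add_zero t)).mono_left nhdsWithin_le_nhds
    · filter_upwards [self_mem_nhdsWithin] with h (hh : 0 < h)
      exact lt_add_of_pos_right t hh
  refine htend.frequently (hfreq.mono ?_)
  rintro h ⟨h1, h2, h3 : 0 < h⟩
  rw [Real.norm_of_nonneg h3.le] at h2
  rw [add_sub_cancel_left, inv_mul_lt_iff₀ h3]
  have hdist : infDist (x (t + h)) F ≤
      infDist (y + h • f y) F + dist (x (t + h)) (y + h • f y) :=
    infDist_le_infDist_add_dist
  have hsplit : x (t + h) - (y + h • f y) =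
      (x (t + h) - x t - h • f (x t)) + (x t - y) + h • (f (x t) - f y) := by
    rw [smul_sub]; abel
  have hlip : ‖h • (f (x t) - f y)‖ ≤ h * (K * infDist (x t) F) := by
    rw [norm_smul, Real.norm_of_nonneg h3.le, hyd, ← dist_eq_norm]
    exact mul_le_mul_of_nonneg_left (hf.dist_le_mul _ _) h3.le
  have hnorm : dist (x (t + h)) (y + h • f y) ≤
      ε * h + infDist (x t) F + h * (K * infDist (x t) F) := by
    rw [dist_eq_norm, hsplit]
    refine norm_add₃_le.trans (add_le_add (add_le_add h2 ?_) hlip)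
    rw [hyd, dist_eq_norm]
  have hsum : h * r = ε * h + ε * h + h * (K * infDist (x t) F) := by rw [hε]; ring
  linarith

/-- Sufficiency direction of the Nagumo theorem: if `F` is a nonempty closed subset of ℝⁿ,
`f` is Lipschitz, and `f x` lies in the contingent cone `T_F(x)` for every `x ∈ F`,
then `F` is positively invariant for `ẋ = f(x)`. -/
theorem nagumo_sufficiency
    {n : ℕ} (F : Set (EuclideanSpace ℝ (Fin n)))
    (hFne : F.Nonempty) (hFcl : IsClosed F)
    (f : EuclideanSpace ℝ (Fin n) → EuclideanSpace ℝ (Fin n))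
    (hf : ∃ K : NNReal, LipschitzWith K f)
    (htan : ∀ x ∈ F,
      Filter.liminf (fun h : ℝ => Metric.infDist (x + h • f x) F / h) (𝓝[>] 0) = 0) :
    ∀ T : ℝ, 0 ≤ T → ∀ x : ℝ → EuclideanSpace ℝ (Fin n),
      (∀ t ∈ Icc (0:ℝ) T, HasDerivAt x (f (x t)) t) →
      x 0 ∈ F → ∀ t ∈ Icc (0:ℝ) T, x t ∈ F := by
  obtain ⟨K, hK⟩ := hf
  intro T _ x hx hx0 t ht
  have hcont : ContinuousOn (fun s => infDist (x s) F) (Icc 0 T) := fun s hs =>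
    ((continuous_infDist_pt F).continuousAt.comp (hx s hs).continuousAt).continuousWithinAt
  have hle := le_gronwallBound_of_liminf_deriv_right_le (δ := 0) (K := K) (ε := 0)
    (f' := fun s => K * infDist (x s) F) hcont
    (fun s hs r hr => frequently_slope_infDist_lt hFne hFcl hK htan
      (hx s (Ico_subset_Icc_self hs)) hr)
    (infDist_zero_of_mem hx0).le (fun s _ => (add_zero _).ge) t ht
  rw [gronwallBound_ε0_δ0] at hle
  exact (hFcl.mem_iff_infDist_zero hFne).2 (hle.antisymm infDist_nonneg)
end

section
/- Let g : ℝⁿ × ℝ → ℝ be continuously differentiable, let F(t) = {y ∈ ℝⁿ : g(y,t) ≤ 0}, and suppose x satisfies g(x, t̂) = 0 and ∇_x g(x, t̂) ≠ 0. Then the temporal contingent cone satisfies exactly T_F^{t̂}(x) = { v ∈ ℝⁿ : ∇_x g(x,t̂)ᵀ v + ∂_t g(x,t̂) ≤ 0 }. (Scalar active-constraint case of Lemma 1, the explicit temporal contingent cone formula, under the full-rank gradient assumption.) -/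
open Filter Metric Set Topology

/-- If a function vanishes at `p` and has positive derivative in the direction `d`, then it is
positive on a conical neighbourhood of the ray from `p` in the direction `d`, close to `p`. -/
theorem HasFDerivAt.exists_eventually_pos_of_norm_sub_le {E : Type*} [NormedAddCommGroup E]
    [NormedSpace ℝ E] {f : E → ℝ} {L : E →L[ℝ] ℝ} {p d : E} (hf : HasFDerivAt f L p)
    (hp : f p = 0) (hd : 0 < L d) :
    ∃ ε > 0, ∀ᶠ h : ℝ in 𝓝[>] 0, ∀ q, ‖q - (p + h • d)‖ ≤ ε * h → 0 < f q := by
  have hL : 0 < ‖L‖ + 1 := by positivity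
  refine ⟨L d / (2 * (‖L‖ + 1)), by positivity, ?_⟩
  set ε := L d / (2 * (‖L‖ + 1)) with hε
  have hε0 : 0 < ε := by positivity
  have hεL : (‖L‖ + 1) * ε = L d / 2 := by rw [hε]; field_simp
  have hM : 0 < ‖d‖ + ε := by positivity
  have hδ : 0 < L d / (4 * (‖d‖ + ε)) := by positivity
  set δ := L d / (4 * (‖d‖ + ε)) with hδdef
  have hδM : δ * (‖d‖ + ε) = L d / 4 := by rw [hδdef]; field_simp
  obtain ⟨ρ, hρ, hball⟩ := Metric.eventually_nhds_iff.1 (hf.isLittleO.bound hδ)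
  filter_upwards [Ioo_mem_nhdsGT (show 0 < ρ / (‖d‖ + ε) by positivity)] with h hh q hq
  have hh0 : 0 < h := hh.1
  have hhρ : h * (‖d‖ + ε) < ρ := (lt_div_iff₀ hM).1 hh.2
  have hdecomp : q - p = h • d + (q - (p + h • d)) := by abel
  have hnorm : ‖q - p‖ ≤ h * (‖d‖ + ε) := by
    calc ‖q - p‖ ≤ ‖h • d‖ + ‖q - (p + h • d)‖ := by
          conv_lhs => rw [hdecomp]
          exact norm_add_le _ _
      _ ≤ h * ‖d‖ + ε * h := by
          rw [norm_smul, Real.norm_of_nonneg hh0.le]; gcongr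
      _ = h * (‖d‖ + ε) := by ring
  have hb := hball (y := q) (by rw [dist_eq_norm]; linarith)
  rw [hp, sub_zero, Real.norm_eq_abs] at hb
  have hb1 := (abs_le.1 hb).1
  have hb2 : δ * ‖q - p‖ ≤ h * (L d / 4) := by
    calc δ * ‖q - p‖ ≤ δ * (h * (‖d‖ + ε)) := by gcongr
      _ = h * (L d / 4) := by rw [← hδM]; ring
  have hLq : L (q - p) = h * L d + L (q - (p + h • d)) := by
    conv_lhs => rw [hdecomp]
    simp
  have hLr : -(h * (L d / 2)) ≤ L (q - (p + h • d)) := by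
    have h1 := (abs_le.1 ((Real.norm_eq_abs _).symm.trans_le (L.le_opNorm (q - (p + h • d))))).1
    have h2 : ‖L‖ * ‖q - (p + h • d)‖ ≤ (‖L‖ + 1) * (ε * h) := by
      gcongr
      linarith
    have h3 : (‖L‖ + 1) * (ε * h) = h * (L d / 2) := by rw [← hεL]; ring
    linarith
  nlinarith [mul_pos hh0 hd]

/-- If a function vanishes at `p` and has negative derivative in the direction `d`, then it is
negative at `p + h • d` for all small `h > 0`. -/
theorem HasFDerivAt.eventually_neg_of_apply_neg {E : Type*} [NormedAddCommGroup E]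
    [NormedSpace ℝ E] {f : E → ℝ} {L : E →L[ℝ] ℝ} {p d : E} (hf : HasFDerivAt f L p)
    (hp : f p = 0) (hd : L d < 0) : ∀ᶠ h : ℝ in 𝓝[>] 0, f (p + h • d) < 0 := by
  obtain ⟨ε, hε, H⟩ := hf.neg.exists_eventually_pos_of_norm_sub_le (d := d)
    (by simpa using hp) (by simpa using hd)
  filter_upwards [H, self_mem_nhdsWithin] with h hh h0
  have := hh (p + h • d) (by simpa using mul_nonneg hε.le (le_of_lt h0))
  simpa using this

/-- Scalar active-constraint case of the explicit temporal contingent cone formula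
(Lemma 1): if `g : ℝⁿ × ℝ → ℝ` is `C¹`, `g(x,t̂) = 0` and `∇_x g(x,t̂) ≠ 0`, then
for `F(t) = {y | g(y,t) ≤ 0}` the temporal contingent cone satisfies exactly
`T_F^{t̂}(x) = {v | ∇_x g(x,t̂)ᵀ v + ∂_t g(x,t̂) ≤ 0}`. -/
theorem temporal_contingent_cone_scalar_active
    {n : ℕ} (g : EuclideanSpace ℝ (Fin n) × ℝ → ℝ)
    (hg : ContDiff ℝ 1 g)
    (F : ℝ → Set (EuclideanSpace ℝ (Fin n)))
    (hF : ∀ t, F t = {y | g (y, t) ≤ 0})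
    (x : EuclideanSpace ℝ (Fin n)) (tHat : ℝ)
    (hx0 : g (x, tHat) = 0)
    (hgrad : fderiv ℝ (fun y => g (y, tHat)) x ≠ 0) :
    ∀ v : EuclideanSpace ℝ (Fin n),
      (Filter.liminf
          (fun h : ℝ => Metric.infDist (x + h • v) (F (tHat + h)) / h) (𝓝[>] 0) = 0
        ↔ fderiv ℝ g (x, tHat) (v, 1) ≤ 0) := by
  intro v
  have hdiff : HasFDerivAt g (fderiv ℝ g (x, tHat)) (x, tHat) :=
    (hg.differentiable one_ne_zero _).hasFDerivAt
  set L := fderiv ℝ g (x, tHat) with hL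
  have hpartial : fderiv ℝ (fun y => g (y, tHat)) x = L.comp (.inl ℝ _ ℝ) :=
    (hdiff.comp x (hasFDerivAt_prodMk_left x tHat)).fderiv
  obtain ⟨w, hw⟩ : ∃ w : EuclideanSpace ℝ (Fin n), L (w, 0) = -1 := by
    obtain ⟨u, hu⟩ := ContinuousLinearMap.exists_ne_zero hgrad
    rw [hpartial] at hu
    replace hu : L (u, 0) ≠ 0 := by simpa using hu
    refine ⟨(-(L (u, 0))⁻¹) • u, ?_⟩
    have : ((-(L (u, 0))⁻¹) • u, (0 : ℝ)) = (-(L (u, 0))⁻¹) • (u, (0 : ℝ)) := by simp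
    rw [this, map_smul, smul_eq_mul]
    field_simp
  have hmem : ∀ c, L (v, 1) < c → ∀ᶠ h : ℝ in 𝓝[>] 0, x + h • (v + c • w) ∈ F (tHat + h) := by
    intro c hc
    have hneg : L (v + c • w, 1) < 0 := by
      have : (v + c • w, (1 : ℝ)) = (v, 1) + c • (w, (0 : ℝ)) := by simp
      rw [this, map_add, map_smul, hw, smul_eq_mul]
      linarith
    filter_upwards [hdiff.eventually_neg_of_apply_neg hx0 hneg] with h hh
    rw [hF]
    simpa using hh.le
  have hupper : ∀ c, 0 ≤ c → L (v, 1) < c →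
      ∀ᶠ h : ℝ in 𝓝[>] 0, infDist (x + h • v) (F (tHat + h)) / h ≤ c * ‖w‖ := by
    intro c hc0 hc
    filter_upwards [hmem c hc, self_mem_nhdsWithin] with h hh h0
    have h0' : 0 < h := h0
    rw [div_le_iff₀ h0']
    refine (infDist_le_dist_of_mem hh).trans_eq ?_
    have : x + h • v - (x + h • (v + c • w)) = -((h * c) • w) := by
      rw [smul_add, smul_smul]; abel
    rw [dist_eq_norm, this, norm_neg, norm_smul, Real.norm_of_nonneg (by positivity)]
    ring
  have hlower : ∀ᶠ h : ℝ in 𝓝[>] 0, 0 ≤ infDist (x + h • v) (F (tHat + h)) / h := by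
    filter_upwards [self_mem_nhdsWithin] with h h0
    exact div_nonneg infDist_nonneg (le_of_lt h0)
  constructor
  · intro hlim
    by_contra! hpos
    obtain ⟨ε, hε, hcone⟩ := hdiff.exists_eventually_pos_of_norm_sub_le hx0 hpos
    have hcobdd : IsCoboundedUnder (· ≥ ·) (𝓝[>] (0 : ℝ))
        (fun h : ℝ => infDist (x + h • v) (F (tHat + h)) / h) :=
      (isBoundedUnder_of_eventually_le
        (hupper (L (v, 1) + 1) (by linarith) (by linarith))).isCoboundedUnder_ge
    have hfreq := frequently_lt_of_liminf_lt hcobdd (hlim.trans_lt hε)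
    obtain ⟨h, hlt, hcone, hne, h0⟩ := (hfreq.and_eventually
      (hcone.and ((hmem (L (v, 1) + 1) (by linarith)).and self_mem_nhdsWithin))).exists
    have h0' : 0 < h := h0
    rw [div_lt_iff₀ h0'] at hlt
    obtain ⟨y, hy, hdist⟩ := (infDist_lt_iff ⟨_, hne⟩).1 hlt
    rw [hF] at hy
    refine (hcone (y, tHat + h) ?_).not_ge hy
    rw [dist_comm, dist_eq_norm] at hdist
    simpa [Prod.norm_def, (norm_nonneg _).trans hdist.le] using hdist.le
  · intro hle
    refine Tendsto.liminf_eq (tendsto_order.2 ⟨fun a ha => ?_, fun a ha => ?_⟩)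
    · filter_upwards [hlower] with h hh using ha.trans_le hh
    · have hc : 0 < a / (‖w‖ + 1) := by positivity
      filter_upwards [hupper _ hc.le (hle.trans_lt hc)] with h hh
      refine hh.trans_lt ?_
      rw [div_mul_eq_mul_div, div_lt_iff₀ (by positivity)]
      nlinarith
end

section
/- Let F : ℝ → 𝒫(ℝⁿ) assign to each time a nonempty subset of ℝⁿ, and suppose F is forward Lipschitz continuous with constant L ≥ 0: for all t ∈ ℝ, all h ≥ 0, and all x ∈ F(t), one has d(x, F(t+h)) ≤ L·h. Then for every t and every x ∈ F(t), the temporal contingent cone T_F^{t}(x) is nonempty; moreover it contains a vector v with ‖v‖ ≤ L. -/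
open Filter Metric Set Topology

theorem liminf_eq_zero_of_nonneg_of_tendsto_comp {α : Type*} {l : Filter α} {f : α → ℝ}
    (hf : ∀ᶠ a in l, 0 ≤ f a) {u : ℕ → α} (hu : Tendsto u atTop l)
    (hfu : Tendsto (fun k => f (u k)) atTop (𝓝 0)) : liminf f l = 0 := by
  have hfreq : ∀ ε > 0, ∃ᶠ a in l, f a ≤ ε := fun ε hε =>
    hu.frequently (hfu.eventually_le_const hε).frequently
  have hbdd : l.IsBoundedUnder (· ≥ ·) f := ⟨0, by simpa using hf⟩
  have hcobdd : l.IsCoboundedUnder (· ≥ ·) f :=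
    IsCoboundedUnder.of_frequently_le (hfreq 1 one_pos)
  exact le_antisymm
    (le_of_forall_pos_le_add fun ε hε => by
      simpa using liminf_le_of_frequently_le (hfreq ε hε) hbdd)
    (le_liminf_of_le hcobdd hf)

/-- Difference quotients along a sequence of positive steps tending to zero, if bounded by quantities
tending to `L`, have a cluster point, and it is contingent to `F` at `x`. -/
theorem exists_liminf_infDist_div_eq_zero {E : Type*} [NormedAddCommGroup E] [NormedSpace ℝ E]
    [ProperSpace E] {F : ℝ → Set E} {t L : ℝ} {x : E} {h b : ℕ → ℝ} {y : ℕ → E}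
    (hpos : ∀ k, 0 < h k) (hlim : Tendsto h atTop (𝓝 0)) (hb : Tendsto b atTop (𝓝 L))
    (hy : ∀ k, y k ∈ F (t + h k)) (hxy : ∀ k, dist x (y k) ≤ b k * h k) :
    ∃ v : E, ‖v‖ ≤ L ∧
      liminf (fun s : ℝ => infDist (x + s • v) (F (t + s)) / s) (𝓝[>] 0) = 0 := by
  set w : ℕ → E := fun k => (h k)⁻¹ • (y k - x) with hw
  have hwb : ∀ k, ‖w k‖ ≤ b k := fun k => by
    rw [hw, norm_smul, norm_inv, Real.norm_of_nonneg (hpos k).le, inv_mul_le_iff₀ (hpos k),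
      ← dist_eq_norm, dist_comm, mul_comm]
    exact hxy k
  have hyw : ∀ k, y k = x + h k • w k := fun k => by
    simp [hw, smul_inv_smul₀ (hpos k).ne']
  obtain ⟨B, hB⟩ := hb.bddAbove_range
  obtain ⟨v, -, φ, hφ, hv⟩ := tendsto_subseq_of_bounded (x := w)
    (isBounded_closedBall (x := (0 : E)) (r := B)) fun k =>
      mem_closedBall_zero_iff.2 ((hwb k).trans (hB (mem_range_self k)))
  refine ⟨v, le_of_tendsto_of_tendsto' hv.norm (hb.comp hφ.tendsto_atTop) fun k => hwb (φ k), ?_⟩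
  refine liminf_eq_zero_of_nonneg_of_tendsto_comp (u := h ∘ φ) ?_
    (tendsto_nhdsWithin_iff.2 ⟨hlim.comp hφ.tendsto_atTop, .of_forall fun k => hpos (φ k)⟩) ?_
  · filter_upwards [self_mem_nhdsWithin] with s hs
    exact div_nonneg infDist_nonneg (le_of_lt hs)
  · refine squeeze_zero (fun k => div_nonneg infDist_nonneg (hpos (φ k)).le) (fun k => ?_)
      (tendsto_iff_dist_tendsto_zero.1 hv)
    rw [Function.comp_apply, Function.comp_apply, div_le_iff₀ (hpos (φ k))]
    refine (infDist_le_dist_of_mem (hy (φ k))).trans_eq ?_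
    rw [hyw, dist_add_left, dist_smul₀, Real.norm_of_nonneg (hpos (φ k)).le, dist_comm, mul_comm]

/-- If the time-varying family of nonempty sets `F(t) ⊆ ℝⁿ` is forward Lipschitz
continuous with constant `L ≥ 0` (i.e. `d(x, F(t+h)) ≤ L·h` for all `x ∈ F(t)`, `h ≥ 0`),
then for every `t` and `x ∈ F(t)` the temporal contingent cone `T_F^t(x)` is nonempty;
moreover it contains a vector `v` with `‖v‖ ≤ L`. -/
theorem forward_lipschitz_nonempty_temporal_cone
    {n : ℕ} (F : ℝ → Set (EuclideanSpace ℝ (Fin n)))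
    (hFne : ∀ t, (F t).Nonempty)
    (L : ℝ) (hL : 0 ≤ L)
    (hfwd : ∀ (t h : ℝ), 0 ≤ h → ∀ x ∈ F t, Metric.infDist x (F (t + h)) ≤ L * h) :
    ∀ (t : ℝ), ∀ x ∈ F t, ∃ v : EuclideanSpace ℝ (Fin n), ‖v‖ ≤ L ∧
      Filter.liminf
        (fun h : ℝ => Metric.infDist (x + h • v) (F (t + h)) / h) (𝓝[>] 0) = 0 := by
  intro t x hx
  set h : ℕ → ℝ := fun k => 1 / ((k : ℝ) + 1)
  have hpos : ∀ k, 0 < h k := fun k => Nat.one_div_pos_of_nat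
  have hlim : Tendsto h atTop (𝓝 0) := tendsto_one_div_add_atTop_nhds_zero_nat
  have hex : ∀ k, ∃ y ∈ F (t + h k), dist x y < (L + h k) * h k := fun k =>
    (infDist_lt_iff (hFne _)).1 <| (hfwd t (h k) (hpos k).le x hx).trans_lt <|
      mul_lt_mul_of_pos_right (lt_add_of_pos_right L (hpos k)) (hpos k)
  choose y hy hxy using hex
  exact exists_liminf_infDist_div_eq_zero hpos hlim (by simpa using hlim.const_add L) hy
    fun k => (hxy k).le
end

section
/- Let g : ℝⁿ → ℝ be continuously differentiable, let F = {y ∈ ℝⁿ : g(y) ≤ 0}, and let x ∈ ℝⁿ satisfy g(x) = 0 and ∇g(x) ≠ 0. Then the contingent cone of F at x is exactly the half-space T_F(x) = { v ∈ ℝⁿ : ∇g(x)ᵀ v ≤ 0 }. (Time-invariant contingent cone formula at a boundary point with full-rank gradient, the time-independent specialization of Lemma 1.) -/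
open Filter Metric Set Topology

section ContingentCone

variable {E : Type*} [NormedAddCommGroup E] [NormedSpace ℝ E]

/-- Difference quotients along a ray converge to the value of the Fréchet derivative. -/
lemma tendsto_ray_quotient {g : E → ℝ} {x : E} (hg : DifferentiableAt ℝ g x) (hx : g x = 0)
    (v : E) : Tendsto (fun h : ℝ => g (x + h • v) / h) (𝓝[>] 0) (𝓝 (fderiv ℝ g x v)) := by
  have := (hg.hasFDerivAt.hasLineDerivAt v).tendsto_slope_zero_right
  simpa [hx, div_eq_inv_mul] using this

/-- Directions in the closed half-space are tangent to the sublevel set. -/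
lemma tendsto_infDist_sublevel_div {g : E → ℝ} {x : E} (hg : DifferentiableAt ℝ g x)
    (hx : g x = 0) (hgrad : fderiv ℝ g x ≠ 0) {v : E} (hv : fderiv ℝ g x v ≤ 0) :
    Tendsto (fun h : ℝ => infDist (x + h • v) {y | g y ≤ 0} / h) (𝓝[>] 0) (𝓝 0) := by
  obtain ⟨w, hw⟩ : ∃ w, fderiv ℝ g x w < 0 := by
    obtain ⟨u, hu⟩ : ∃ u, fderiv ℝ g x u ≠ 0 := by
      by_contra! H
      exact hgrad (ContinuousLinearMap.ext H)
    rcases lt_or_gt_of_ne hu with h | h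
    · exact ⟨u, h⟩
    · exact ⟨-u, by simpa using h⟩
  rw [Metric.tendsto_nhds]
  intro ε hε
  have hw0 : 0 < ‖w‖ + 1 := by positivity
  set δ := ε / (‖w‖ + 1) with hδ
  have hδ0 : 0 < δ := div_pos hε hw0
  have hneg : fderiv ℝ g x (v + δ • w) < 0 := by
    simp only [map_add, map_smul, smul_eq_mul]
    linarith [mul_neg_of_pos_of_neg hδ0 hw]
  filter_upwards [(tendsto_ray_quotient hg hx (v + δ • w)).eventually_lt_const hneg,
    self_mem_nhdsWithin] with h hh (hpos : 0 < h)
  have hmem : x + h • (v + δ • w) ∈ {y | g y ≤ 0} := (neg_of_div_neg_left hh hpos.le).le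
  have hle : infDist (x + h • v) {y | g y ≤ 0} ≤ h * (δ * ‖w‖) := by
    refine (infDist_le_dist_of_mem hmem).trans_eq ?_
    rw [dist_eq_norm, show x + h • v - (x + h • (v + δ • w)) = -(h • δ • w) by
      rw [smul_add]; abel, norm_neg, norm_smul, norm_smul, Real.norm_of_nonneg hpos.le,
      Real.norm_of_nonneg hδ0.le]
  rw [Real.dist_eq, sub_zero, abs_of_nonneg (div_nonneg infDist_nonneg hpos.le),
    div_lt_iff₀ hpos]
  have hδw : δ * (‖w‖ + 1) = ε := div_mul_cancel₀ _ hw0.ne'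
  nlinarith [mul_pos hpos hδ0]

/-- Directions outside the closed half-space leave the sublevel set at a linear rate. -/
lemma exists_eventually_le_infDist_sublevel_div {g : E → ℝ} {x : E} (hg : ContDiffAt ℝ 1 g x)
    (hx : g x = 0) {v : E} (hv : 0 < fderiv ℝ g x v) :
    ∃ δ > 0, ∀ᶠ h : ℝ in 𝓝[>] 0, δ ≤ infDist (x + h • v) {y | g y ≤ 0} / h := by
  obtain ⟨K, s, hs, hK⟩ := hg.exists_lipschitzOnWith
  obtain ⟨r, hr, hrs⟩ := Metric.mem_nhds_iff.1 hs
  set c := fderiv ℝ g x v with hc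
  have hK0 : (0 : ℝ) < K + 1 := by positivity
  set δ := c / 2 / (K + 1) with hδ
  have hδ0 : 0 < δ := by positivity
  have hδK : δ * (K + 1) = c / 2 := div_mul_cancel₀ _ hK0.ne'
  refine ⟨δ, hδ0, ?_⟩
  have hsmall : ∀ᶠ h : ℝ in 𝓝[>] 0, h * (‖v‖ + δ) < r := by
    have : Tendsto (fun h : ℝ => h * (‖v‖ + δ)) (𝓝[>] 0) (𝓝 (0 * (‖v‖ + δ))) :=
      (Continuous.tendsto (by fun_prop) 0).mono_left nhdsWithin_le_nhds
    exact this.eventually_lt_const (by simpa using hr)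
  filter_upwards [(tendsto_ray_quotient (hg.differentiableAt one_ne_zero) hx v).eventually_const_lt
    (half_lt_self hv), hsmall, self_mem_nhdsWithin] with h hh hhr (hpos : 0 < h)
  rw [le_div_iff₀ hpos]
  rw [lt_div_iff₀ hpos] at hh
  refine (le_infDist ⟨x, hx.le⟩).2 fun y (hy : g y ≤ 0) => ?_
  by_contra! hlt
  have hhv : dist (x + h • v) x = h * ‖v‖ := by
    simp [dist_eq_norm, norm_smul, abs_of_pos hpos]
  have h1 : x + h • v ∈ s := hrs (by
    rw [mem_ball, hhv]
    nlinarith [mul_pos hpos hδ0])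
  have h2 : y ∈ s := hrs (by
    rw [mem_ball]
    have := dist_triangle_left y x (x + h • v)
    linarith)
  have hL := (le_abs_self _).trans (hK.dist_le_mul _ h1 _ h2)
  have hKd : (K : ℝ) * dist (x + h • v) y ≤ K * (δ * h) :=
    mul_le_mul_of_nonneg_left hlt.le K.coe_nonneg
  nlinarith [mul_pos hpos hδ0]

end ContingentCone

/-- Time-invariant contingent cone formula at a boundary point with nonvanishing gradient
(the time-independent specialization of Lemma 1): for `C¹` `g : ℝⁿ → ℝ`,
`F = {y | g(y) ≤ 0}`, `g(x) = 0` and `∇g(x) ≠ 0`, the contingent cone of `F` at `x` is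
exactly the half-space `{v | ∇g(x)ᵀ v ≤ 0}`. -/
theorem contingent_cone_halfspace
    {n : ℕ} (g : EuclideanSpace ℝ (Fin n) → ℝ) (hg : ContDiff ℝ 1 g)
    (F : Set (EuclideanSpace ℝ (Fin n))) (hF : F = {y | g y ≤ 0})
    (x : EuclideanSpace ℝ (Fin n)) (hx0 : g x = 0) (hgrad : fderiv ℝ g x ≠ 0) :
    ∀ v : EuclideanSpace ℝ (Fin n),
      (Filter.liminf (fun h : ℝ => Metric.infDist (x + h • v) F / h) (𝓝[>] 0) = 0 ↔
        fderiv ℝ g x v ≤ 0) := by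
  intro v
  subst hF
  constructor
  · intro hlim
    by_contra! hv
    obtain ⟨δ, hδ, hev⟩ := exists_eventually_le_infDist_sublevel_div hg.contDiffAt hx0 hv
    have hbdd : ∀ᶠ h : ℝ in 𝓝[>] 0, infDist (x + h • v) {y | g y ≤ 0} / h ≤ ‖v‖ := by
      filter_upwards [self_mem_nhdsWithin] with h (hpos : 0 < h)
      rw [div_le_iff₀ hpos]
      refine (infDist_le_dist_of_mem (show x ∈ {y | g y ≤ 0} from hx0.le)).trans_eq ?_
      simp [dist_eq_norm, norm_smul, abs_of_pos hpos, mul_comm]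
    have := le_liminf_of_le (isBoundedUnder_of_eventually_le hbdd).isCoboundedUnder_ge hev
    linarith
  · intro hv
    exact (tendsto_infDist_sublevel_div (hg.differentiable one_ne_zero x) hx0 hgrad hv).liminf_eq
end
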